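/- arXiv:math/0406540 — 4 statements merged into one kernel-verified Lean document; each statement's English description precedes it below -/
import Mathlib

section
/- Let Σ be a nonempty closed and nowhere dense subset of X. Then, taking Λ = ℕ with its usual order, there exists a family α = (α_l)_{l∈ℕ} ∈ J_{ℕ,Σ}(X) such that α_l = 1 on Σ for every l ∈ ℕ. In particular, the ideal J_{ℕ,Σ}(X) contains an element all of whose terms equal 1 on the nonempty set Σ, so J_{ℕ,Σ}(X) ≠ {0}. -/
open scoped Topology

/-- The `i`-th partial derivative of a function `ℝⁿ → ℝ`. -/
noncomputable def pderivI {n : ℕ} (i : Fin n) (f : (Fin n → ℝ) → ℝ) : (Fin n → ℝ) → ℝ :=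
  fun x => fderiv ℝ f x (Pi.single i 1)

/-- The iterated partial derivative `D^p` associated with a multi-index `p ∈ ℕⁿ`. -/
noncomputable def Dpartial {n : ℕ} (p : Fin n → ℕ) (f : (Fin n → ℝ) → ℝ) : (Fin n → ℝ) → ℝ :=
  (List.finRange n).foldr (fun i g => (pderivI i)^[p i] g) f

/-- The algebra `C^∞(X)` of smooth real-valued functions on (the open set) `X ⊆ ℝⁿ`,
realized as the subalgebra of `(Fin n → ℝ) → ℝ` of functions smooth on `X`. -/
def SmoothA (n : ℕ) (X : Set (Fin n → ℝ)) : Subalgebra ℝ ((Fin n → ℝ) → ℝ) where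
  carrier := {f | ContDiffOn ℝ (⊤ : ℕ∞) f X}
  mul_mem' hf hg := hf.mul hg
  add_mem' hf hg := hf.add hg
  algebraMap_mem' r := contDiffOn_const

/-- The asymptotic vanishing condition defining `J_{Λ,Σ}(U)`, stated for a raw family of
functions: for every `x ∈ U ∖ Σ` there is `λ ∈ Λ` such that all partial derivatives
(including order `0`) of `w_μ` vanish at `x` for all `μ ≥ λ`. -/
def JvanP (Λ : Type*) [PartialOrder Λ] {n : ℕ} (U Sg : Set (Fin n → ℝ))
    (w : Λ → (Fin n → ℝ) → ℝ) : Prop :=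
  ∀ x ∈ U \ Sg, ∃ l : Λ, ∀ m : Λ, l ≤ m → ∀ p : Fin n → ℕ, Dpartial p (w m) x = 0

/-- The asymptotically vanishing set `J_{Λ,Σ}(X)` inside the product ring `(C^∞(X))^Λ`. -/
def Jset (Λ : Type*) [PartialOrder Λ] {n : ℕ} (X Sg : Set (Fin n → ℝ)) :
    Set (Λ → (SmoothA n X)) :=
  {w | JvanP Λ X Sg (fun m => ((w m : (Fin n → ℝ) → ℝ)))}

/-- `J_{Λ,S}(X) = ∪_{Σ ∈ S} J_{Λ,Σ}(X)` for a family `S` of singularity sets. -/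
def JsetFam (Λ : Type*) [PartialOrder Λ] {n : ℕ} (X : Set (Fin n → ℝ))
    (S : Set (Set (Fin n → ℝ))) : Set (Λ → (SmoothA n X)) :=
  ⋃ Sg ∈ S, Jset Λ X Sg

/-- A family `S` of subsets of `X` is admissible : it is nonempty, consists of subsets
of `X`, and any two members have a common upper bound in `S` containing their union. -/
def Admissible {n : ℕ} (X : Set (Fin n → ℝ)) (S : Set (Set (Fin n → ℝ))) : Prop :=
  S.Nonempty ∧ (∀ Sg ∈ S, Sg ⊆ X) ∧ ∀ Sg ∈ S, ∀ Sg' ∈ S, ∃ Sg'' ∈ S, Sg ∪ Sg' ⊆ Sg''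

/-- Right directedness of a partial order. -/
def RightDirected (Λ : Type*) [PartialOrder Λ] : Prop :=
  ∀ a b : Λ, ∃ c : Λ, a ≤ c ∧ b ≤ c


theorem pderivI_eventuallyZero {n : ℕ} (i : Fin n) {f : (Fin n → ℝ) → ℝ} {x : Fin n → ℝ}
    (h : f =ᶠ[𝓝 x] 0) : pderivI i f =ᶠ[𝓝 x] 0 := by
  filter_upwards [h.fderiv (𝕜 := ℝ)] with y hy
  simp [pderivI, hy]

theorem iter_pderivI_eventuallyZero {n : ℕ} (i : Fin n) {x : Fin n → ℝ} (k : ℕ) :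
    ∀ {f : (Fin n → ℝ) → ℝ}, f =ᶠ[𝓝 x] 0 → (pderivI i)^[k] f =ᶠ[𝓝 x] 0 := by
  induction k with
  | zero => intro f h; exact h
  | succ k ih =>
    intro f h
    rw [Function.iterate_succ_apply]
    exact ih (pderivI_eventuallyZero i h)

theorem Dpartial_eq_zero {n : ℕ} (p : Fin n → ℕ) {f : (Fin n → ℝ) → ℝ} {x : Fin n → ℝ}
    (h : f =ᶠ[𝓝 x] 0) : Dpartial p f x = 0 := by
  have key : Dpartial p f =ᶠ[𝓝 x] 0 := by
    unfold Dpartial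
    induction List.finRange n with
    | nil => exact h
    | cons a t ih =>
      rw [List.foldr_cons]
      exact iter_pderivI_eventuallyZero a (p a) ih
  exact key.eq_of_nhds

/-- for a nonempty `Σ ⊆ X` closed and nowhere dense in `X`, the ideal
`J_{ℕ,Σ}(X)` contains a family `α` with `α_l = 1` on `Σ` for all `l`; in particular
`J_{ℕ,Σ}(X) ≠ {0}`. -/
theorem stmt10 {n : ℕ} (hn : 0 < n) (X : Set (Fin n → ℝ)) (hXo : IsOpen X) (hXne : X.Nonempty)
    (Sg : Set (Fin n → ℝ)) (hSgX : Sg ⊆ X) (hSgne : Sg.Nonempty)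
    (hcl : IsClosed (Subtype.val ⁻¹' Sg : Set X))
    (hnd : IsNowhereDense (Subtype.val ⁻¹' Sg : Set X)) :
    ∃ α : ℕ → SmoothA n X, α ∈ Jset ℕ X Sg ∧
      (∀ l : ℕ, ∀ x ∈ Sg, ((α l : (Fin n → ℝ) → ℝ)) x = 1) ∧
      Jset ℕ X Sg ≠ {0} := by
  obtain ⟨C, hC, hCe⟩ := isClosed_induced_iff.mp hcl
  obtain ⟨f, hfs, hf, hfr⟩ := hC.isOpen_compl.exists_contDiff_support_eq (n := (⊤ : ℕ∞))
  have hmem : ∀ x ∈ X, (x ∈ C ↔ x ∈ Sg) := fun x hx => by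
    have := Set.ext_iff.mp hCe ⟨x, hx⟩
    simpa using this
  have hf0 : ∀ x ∈ X, (f x = 0 ↔ x ∈ Sg) := fun x hx => by
    rw [← hmem x hx]
    have := Set.ext_iff.mp hfs x
    simp only [Function.mem_support, Set.mem_compl_iff] at this
    exact not_iff_not.mp this
  let g : ℕ → (Fin n → ℝ) → ℝ := fun l x => 1 - Real.smoothTransition (l * f x - 1)
  have hg : ∀ l, ContDiff ℝ (⊤ : ℕ∞) (g l) := fun l =>
    contDiff_const.sub (Real.smoothTransition.contDiff.comp
      ((contDiff_const.mul hf).sub contDiff_const))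
  let α : ℕ → SmoothA n X := fun l => ⟨g l, (hg l).contDiffOn⟩
  have hα : α ∈ Jset ℕ X Sg := by
    rintro x ⟨hx, hxS⟩
    have hpos : 0 < f x := by
      have h1 : f x ≠ 0 := fun h => hxS ((hf0 x hx).mp h)
      have h2 : 0 ≤ f x := (hfr ⟨x, rfl⟩).1
      exact lt_of_le_of_ne h2 h1.symm
    obtain ⟨l, hl⟩ := exists_nat_gt (2 / f x)
    refine ⟨l, fun m hm p => Dpartial_eq_zero p ?_⟩
    have hlm : 2 < (m : ℝ) * f x := by
      have h3 : (l : ℝ) ≤ m := by exact_mod_cast hm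
      exact (div_lt_iff₀ hpos).mp (hl.trans_le h3)
    have hcont : Continuous fun y => (m : ℝ) * f y := continuous_const.mul hf.continuous
    filter_upwards [hcont.continuousAt.eventually (lt_mem_nhds hlm)] with y hy
    change 1 - Real.smoothTransition (m * f y - 1) = 0
    rw [Real.smoothTransition.one_of_one_le (by linarith), sub_self]
  have h1 : ∀ l : ℕ, ∀ x ∈ Sg, ((α l : (Fin n → ℝ) → ℝ)) x = 1 := by
    intro l x hx
    change 1 - Real.smoothTransition (l * f x - 1) = 1
    rw [(hf0 x (hSgX hx)).mpr hx, Real.smoothTransition.zero_of_nonpos (by norm_num), sub_zero]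
  refine ⟨α, hα, h1, fun h => ?_⟩
  rw [h, Set.mem_singleton_iff] at hα
  obtain ⟨x, hx⟩ := hSgne
  have := h1 0 x hx
  rw [hα] at this
  simp at this
end

section
/- Let Λ be a nonempty right directed partially ordered set and S an admissible family of subsets of X satisfying (LFA) and (CR). Let V ⊆ X be nonempty open, let (V_i)_{i∈I} be a family of open sets with V = ∪_{i∈I} V_i, and let w ∈ (C^∞(V))^Λ be such that for every i ∈ I the restricted family (w_λ|_{V_i})_{λ∈Λ} belongs to J_{Λ,S|_{V_i}}(V_i). Then w ∈ J_{Λ,S|_V}(V). (This is the separation property of the presheaf of multi-foam algebras: two sections of B_{Λ,S|_V}(V) agreeing on all members of an open cover are equal.) -/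
open scoped Topology

/-- The restriction `J_{Λ,S|_U}(U) = ∪_{Σ∈S} J_{Λ,Σ∩U}(U)` of the multi-foam ideal to an
open subset `U`. -/
def JsetFamU (Λ : Type*) [PartialOrder Λ] {n : ℕ} (U : Set (Fin n → ℝ))
    (S : Set (Set (Fin n → ℝ))) : Set (Λ → (SmoothA n U)) :=
  {w | ∃ Sg ∈ S, JvanP Λ U (Sg ∩ U) (fun m => ((w m : (Fin n → ℝ) → ℝ)))}

/-- (LFA) : local finite additivity of a family of singularity sets. -/
def LFA {n : ℕ} (X : Set (Fin n → ℝ)) (S : Set (Set (Fin n → ℝ))) : Prop :=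
  ∀ Sl : ℕ → Set (Fin n → ℝ), (∀ l : ℕ, Sl l ∈ S) →
    ∀ U : Set (Fin n → ℝ), U ⊆ X → IsOpen U → U.Nonempty →
      (∀ x ∈ U, ∃ Δ : Set (Fin n → ℝ), Δ ⊆ U ∧ Δ ∈ nhds x ∧
        {l : ℕ | (Sl l ∩ Δ).Nonempty}.Finite) →
      ∃ Sg ∈ S, (⋃ l : ℕ, Sl l) ∩ U = Sg ∩ U

/-- (CR) : closed-restriction stability of a family of singularity sets. -/
def CRstable {n : ℕ} (X : Set (Fin n → ℝ)) (S : Set (Set (Fin n → ℝ))) : Prop :=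
  ∀ Sg ∈ S, ∀ U : Set (Fin n → ℝ), U ⊆ X → IsOpen U → U.Nonempty →
    ∀ K : Set (Fin n → ℝ), K ⊆ U → (∃ C : Set (Fin n → ℝ), IsClosed C ∧ K = C ∩ U) →
      ∃ Sg' ∈ S, Sg' ∩ U = Sg ∩ K

/-- separation property of the presheaf of multi-foam algebras — if a family
of smooth functions on `V` belongs to `J_{Λ,S|_{V_i}}(V_i)` for every member of an open
cover `V = ∪ V_i`, then it belongs to `J_{Λ,S|_V}(V)`. -/
theorem stmt12 {n : ℕ} (hn : 0 < n) (X : Set (Fin n → ℝ)) (hXo : IsOpen X) (hXne : X.Nonempty)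
    (Λ : Type*) [PartialOrder Λ] [Nonempty Λ] (hdir : RightDirected Λ)
    (S : Set (Set (Fin n → ℝ))) (hS : Admissible X S) (hlfa : LFA X S) (hcr : CRstable X S)
    (V : Set (Fin n → ℝ)) (hVX : V ⊆ X) (hVo : IsOpen V) (hVne : V.Nonempty)
    {ι : Type*} (Vi : ι → Set (Fin n → ℝ)) (hVio : ∀ i, IsOpen (Vi i))
    (hVU : V = ⋃ i, Vi i)
    (w : Λ → SmoothA n V)
    (hloc : ∀ i : ι, ∃ Sg ∈ S,
      JvanP Λ (Vi i) (Sg ∩ Vi i) (fun m => ((w m : (Fin n → ℝ) → ℝ)))) :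
    ∃ Sg ∈ S, JvanP Λ V (Sg ∩ V) (fun m => ((w m : (Fin n → ℝ) → ℝ))) := by
  choose Sg hSg hJ using hloc
  obtain ⟨T, hTc, hT⟩ := TopologicalSpace.isOpen_iUnion_countable Vi hVio
  have hTne : T.Nonempty := by
    obtain ⟨x, hx⟩ := hVne
    rw [hVU, ← hT] at hx
    simp only [Set.mem_iUnion] at hx
    obtain ⟨i, hi, _⟩ := hx
    exact ⟨i, hi⟩
  obtain ⟨f, hf⟩ := hTc.exists_eq_range hTne
  have hcov : ∀ x ∈ V, ∃ l, x ∈ Vi (f l) := by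
    intro x hx
    rw [hVU, ← hT, hf] at hx
    simpa using hx
  obtain ⟨v, hvo, hvU, hvlf, hvs⟩ := precise_refinement
    (fun l : ℕ => ((↑) : V → (Fin n → ℝ)) ⁻¹' (Vi (f l)))
    (fun l => (hVio _).preimage continuous_subtype_val)
    (by
      ext x
      simpa using hcov x x.2)
  obtain ⟨K, hKU, hKc, hKv⟩ := exists_iUnion_eq_closed_subset hvo (fun x => hvlf.point_finite x) hvU
  have hex : ∀ l, ∃ Sg' ∈ S, Sg' ∩ V = Sg (f l) ∩ (((↑) : V → (Fin n → ℝ)) '' K l) := by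
    intro l
    refine hcr _ (hSg _) V hVX hVo hVne _ (by simp) ?_
    obtain ⟨C, hC, hCK⟩ := isClosed_induced_iff.1 (hKc l)
    refine ⟨C, hC, ?_⟩
    rw [← hCK, Subtype.image_preimage_coe, Set.inter_comm]
  choose Sl hSl hSlK using hex
  obtain ⟨A, hA, hAe⟩ := hlfa Sl hSl V hVX hVo hVne (by
    intro x hx
    obtain ⟨t, ht, hfin⟩ := hvlf ⟨x, hx⟩
    refine ⟨((↑) : V → (Fin n → ℝ)) '' t, by simp,
      hVo.isOpenEmbedding_subtypeVal.image_mem_nhds.2 ht, hfin.subset ?_⟩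
    rintro l ⟨_, hy, y, hyt, rfl⟩
    have h : (y : Fin n → ℝ) ∈ Sl l ∩ V := ⟨hy, y.2⟩
    rw [hSlK] at h
    obtain ⟨_, z, hz, hzy⟩ := h
    have := Subtype.ext hzy
    subst this
    exact ⟨z, hKv l hz, hyt⟩)
  refine ⟨A, hA, ?_⟩
  rintro x ⟨hxV, hxA⟩
  have hx : (⟨x, hxV⟩ : V) ∈ ⋃ l, K l := by rw [hKU]; trivial
  obtain ⟨l, hl⟩ := Set.mem_iUnion.1 hx
  refine hJ (f l) x ⟨hvs l (hKv l hl), fun h => hxA ?_⟩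
  rw [← hAe]
  have h2 : x ∈ Sl l ∩ V := by
    rw [hSlK]
    exact ⟨h.1, ⟨x, hxV⟩, hl, rfl⟩
  exact ⟨Set.mem_iUnion.2 ⟨l, h2.1⟩, hxV⟩
end

section
/- Let Λ be a nonempty right directed partially ordered set and S an admissible family of subsets of X satisfying (LFA) and (CR). Let V ⊆ X be nonempty open, let (V_i)_{i∈I} be a family of open sets with V = ∪_{i∈I} V_i, and for each i ∈ I let t_i ∈ (C^∞(V_i))^Λ be given such that for all i, j ∈ I with V_i ∩ V_j ≠ ∅ the family ((t_i)_λ|_{V_i∩V_j} − (t_j)_λ|_{V_i∩V_j})_{λ∈Λ} belongs to J_{Λ,S|_{V_i∩V_j}}(V_i∩V_j). Then there exists t ∈ (C^∞(V))^Λ such that for every i ∈ I the family (t_λ|_{V_i} − (t_i)_λ)_{λ∈Λ} belongs to J_{Λ,S|_{V_i}}(V_i). (This is the gluing property of the presheaf of multi-foam algebras: compatible local sections glue to a global section.) -/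
open scoped Topology

def FlatL {n : ℕ} (x : Fin n → ℝ) : List (Fin n) → ((Fin n → ℝ) → ℝ) → Prop
  | [], g => g x = 0
  | j :: L, g => ∀ k : ℕ, FlatL x L ((pderivI j)^[k] g)

theorem pderivI_congr {n : ℕ} {W : Set (Fin n → ℝ)} (hW : IsOpen W) (j : Fin n)
    {f g : (Fin n → ℝ) → ℝ} (h : Set.EqOn f g W) : Set.EqOn (pderivI j f) (pderivI j g) W := by
  intro y hy
  have : f =ᶠ[𝓝 y] g := h.eventuallyEq_of_mem (hW.mem_nhds hy)
  simp only [pderivI, this.fderiv_eq]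

theorem pderivI_iter_congr {n : ℕ} {W : Set (Fin n → ℝ)} (hW : IsOpen W) (j : Fin n) (k : ℕ)
    {f g : (Fin n → ℝ) → ℝ} (h : Set.EqOn f g W) :
    Set.EqOn ((pderivI j)^[k] f) ((pderivI j)^[k] g) W := by
  induction k generalizing f g with
  | zero => exact h
  | succ k ih => exact ih (pderivI_congr hW j h)

theorem pderivI_smooth {n : ℕ} {W : Set (Fin n → ℝ)} (hW : IsOpen W) (j : Fin n)
    {f : (Fin n → ℝ) → ℝ} (hf : ContDiffOn ℝ (⊤ : ℕ∞) f W) :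
    ContDiffOn ℝ (⊤ : ℕ∞) (pderivI j f) W := by
  have := hf.fderiv_of_isOpen hW (m := (⊤ : ℕ∞)) (by simp)
  exact this.clm_apply contDiffOn_const

theorem pderivI_iter_smooth {n : ℕ} {W : Set (Fin n → ℝ)} (hW : IsOpen W) (j : Fin n) (k : ℕ)
    {f : (Fin n → ℝ) → ℝ} (hf : ContDiffOn ℝ (⊤ : ℕ∞) f W) :
    ContDiffOn ℝ (⊤ : ℕ∞) ((pderivI j)^[k] f) W := by
  induction k generalizing f with
  | zero => exact hf
  | succ k ih => exact ih (pderivI_smooth hW j hf)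

theorem smooth_diffAt {n : ℕ} {W : Set (Fin n → ℝ)} (hW : IsOpen W)
    {f : (Fin n → ℝ) → ℝ} (hf : ContDiffOn ℝ (⊤ : ℕ∞) f W) {y : Fin n → ℝ} (hy : y ∈ W) :
    DifferentiableAt ℝ f y :=
  (hf.contDiffAt (hW.mem_nhds hy)).differentiableAt (by simp)

theorem pderivI_add_on {n : ℕ} {W : Set (Fin n → ℝ)} (hW : IsOpen W) (j : Fin n)
    {f g : (Fin n → ℝ) → ℝ} (hf : ContDiffOn ℝ (⊤ : ℕ∞) f W) (hg : ContDiffOn ℝ (⊤ : ℕ∞) g W) :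
    Set.EqOn (pderivI j (f + g)) (pderivI j f + pderivI j g) W := by
  intro y hy
  simp [pderivI, fderiv_add (smooth_diffAt hW hf hy) (smooth_diffAt hW hg hy)]

theorem pderivI_mul_on {n : ℕ} {W : Set (Fin n → ℝ)} (hW : IsOpen W) (j : Fin n)
    {f g : (Fin n → ℝ) → ℝ} (hf : ContDiffOn ℝ (⊤ : ℕ∞) f W) (hg : ContDiffOn ℝ (⊤ : ℕ∞) g W) :
    Set.EqOn (pderivI j (f * g)) (pderivI j f * g + f * pderivI j g) W := by
  intro y hy
  simp [pderivI, fderiv_mul (smooth_diffAt hW hf hy) (smooth_diffAt hW hg hy)]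
  ring

theorem pderivI_iter_add_on {n : ℕ} {W : Set (Fin n → ℝ)} (hW : IsOpen W) (j : Fin n) (k : ℕ)
    {f g : (Fin n → ℝ) → ℝ} (hf : ContDiffOn ℝ (⊤ : ℕ∞) f W) (hg : ContDiffOn ℝ (⊤ : ℕ∞) g W) :
    Set.EqOn ((pderivI j)^[k] (f + g)) ((pderivI j)^[k] f + (pderivI j)^[k] g) W := by
  induction k generalizing f g with
  | zero => exact fun _ _ => rfl
  | succ k ih =>
    exact (pderivI_iter_congr hW j k (pderivI_add_on hW j hf hg)).trans
      (ih (pderivI_smooth hW j hf) (pderivI_smooth hW j hg))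

theorem FlatL.congr {n : ℕ} {W : Set (Fin n → ℝ)} (hW : IsOpen W) {x : Fin n → ℝ} (hx : x ∈ W)
    (L : List (Fin n)) {f g : (Fin n → ℝ) → ℝ} (h : Set.EqOn f g W) (hf : FlatL x L f) :
    FlatL x L g := by
  induction L generalizing f g with
  | nil => exact (h hx).symm.trans hf
  | cons j L ih => exact fun k => ih (pderivI_iter_congr hW j k h) (hf k)

theorem FlatL.add {n : ℕ} {W : Set (Fin n → ℝ)} (hW : IsOpen W) {x : Fin n → ℝ} (hx : x ∈ W)
    (L : List (Fin n)) {f g : (Fin n → ℝ) → ℝ}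
    (hfs : ContDiffOn ℝ (⊤ : ℕ∞) f W) (hgs : ContDiffOn ℝ (⊤ : ℕ∞) g W)
    (hf : FlatL x L f) (hg : FlatL x L g) : FlatL x L (f + g) := by
  induction L generalizing f g with
  | nil =>
    have h1 : f x = 0 := hf
    have h2 : g x = 0 := hg
    show f x + g x = 0
    rw [h1, h2, add_zero]
  | cons j L ih =>
    intro k
    exact FlatL.congr hW hx L (pderivI_iter_add_on hW j k hfs hgs).symm
      (ih (pderivI_iter_smooth hW j k hfs) (pderivI_iter_smooth hW j k hgs) (hf k) (hg k))

theorem FlatL.mul {n : ℕ} {W : Set (Fin n → ℝ)} (hW : IsOpen W) {x : Fin n → ℝ} (hx : x ∈ W)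
    (L : List (Fin n)) {f g : (Fin n → ℝ) → ℝ}
    (hfs : ContDiffOn ℝ (⊤ : ℕ∞) f W) (hgs : ContDiffOn ℝ (⊤ : ℕ∞) g W)
    (hg : FlatL x L g) : FlatL x L (f * g) := by
  induction L generalizing f g with
  | nil =>
    have h2 : g x = 0 := hg
    show f x * g x = 0
    rw [h2, mul_zero]
  | cons j L ih =>
    intro k
    induction k generalizing f g with
    | zero => exact ih hfs hgs (hg 0)
    | succ k ihk =>
      have hf' := pderivI_smooth hW j hfs
      have hg' := pderivI_smooth hW j hgs
      have h1 := ihk hf' hgs hg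
      have h2 := ihk hfs hg' (fun k => hg (k + 1))
      have e := (pderivI_iter_congr hW j k (pderivI_mul_on hW j hfs hgs)).trans
        (pderivI_iter_add_on hW j k (hf'.mul hgs) (hfs.mul hg'))
      exact FlatL.congr hW hx L e.symm
        (FlatL.add hW hx L (pderivI_iter_smooth hW j k (hf'.mul hgs))
          (pderivI_iter_smooth hW j k (hfs.mul hg')) h1 h2)

theorem FlatL.zero {n : ℕ} (x : Fin n → ℝ) (L : List (Fin n)) : FlatL x L 0 := by
  induction L with
  | nil => rfl
  | cons j L ih =>
    intro k
    have h : pderivI j 0 = 0 := by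
      funext y
      simp [pderivI]
    rwa [Function.iterate_fixed h k]

theorem FlatL.sum {n : ℕ} {W : Set (Fin n → ℝ)} (hW : IsOpen W) {x : Fin n → ℝ} (hx : x ∈ W)
    (L : List (Fin n)) {α : Type*} (F : Finset α) (f : α → (Fin n → ℝ) → ℝ)
    (hfs : ∀ l ∈ F, ContDiffOn ℝ (⊤ : ℕ∞) (f l) W)
    (hf : ∀ l ∈ F, FlatL x L (f l)) :
    ContDiffOn ℝ (⊤ : ℕ∞) (∑ l ∈ F, f l) W ∧ FlatL x L (∑ l ∈ F, f l) := by
  classical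
  induction F using Finset.induction_on with
  | empty => exact ⟨contDiffOn_const, FlatL.zero x L⟩
  | insert a F ha ih =>
    obtain ⟨h1, h2⟩ := ih (fun l hl => hfs l (Finset.mem_insert_of_mem hl))
      (fun l hl => hf l (Finset.mem_insert_of_mem hl))
    rw [Finset.sum_insert ha]
    have h3 := hfs a (Finset.mem_insert_self a F)
    exact ⟨h3.add h1, FlatL.add hW hx L h3 h1 (hf a (Finset.mem_insert_self a F)) h2⟩

theorem flat_iff_aux {n : ℕ} (x : Fin n → ℝ) (L : List (Fin n)) (hL : L.Nodup)
    (f : (Fin n → ℝ) → ℝ) :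
    (∀ p : Fin n → ℕ, L.reverse.foldr (fun i g => (pderivI i)^[p i] g) f x = 0) ↔
      FlatL x L f := by
  induction L generalizing f with
  | nil => simp [FlatL]
  | cons j L ih =>
    rw [List.nodup_cons] at hL
    simp only [List.reverse_cons, List.foldr_append, List.foldr_cons, List.foldr_nil, FlatL]
    constructor
    · intro h k
      rw [← ih hL.2]
      intro p
      have := h (Function.update p j k)
      rw [Function.update_self] at this
      rw [← this]
      refine congrFun ?_ x
      apply List.foldr_ext
      intro i hi g
      rw [Function.update_of_ne]
      rintro rfl
      exact hL.1 (List.mem_reverse.1 hi)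
    · intro h p
      exact (ih hL.2 _).2 (h (p j)) p

theorem flat_iff {n : ℕ} (x : Fin n → ℝ) (f : (Fin n → ℝ) → ℝ) :
    (∀ p : Fin n → ℕ, Dpartial p f x = 0) ↔ FlatL x (List.finRange n).reverse f := by
  rw [← flat_iff_aux x _ (List.nodup_reverse.2 (List.nodup_finRange n)), List.reverse_reverse]
  rfl

open scoped Manifold ContDiff in
theorem pou_exists {n : ℕ} {V : Set (Fin n → ℝ)} (hV : IsOpen V) (W : ℕ → Set (Fin n → ℝ))
    (hW : ∀ l, IsOpen (W l)) (hVW : V ⊆ ⋃ l, W l) :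
    ∃ (ψ : ℕ → (Fin n → ℝ) → ℝ) (C : ℕ → Set (Fin n → ℝ)),
      (∀ l, ContDiffOn ℝ (⊤ : ℕ∞) (ψ l) V) ∧ (∀ l, IsClosed (C l)) ∧ (∀ l, C l ∩ V ⊆ W l) ∧
      (∀ l, ∀ x ∈ V, x ∉ C l → ψ l x = 0) ∧
      ∀ x ∈ V, ∃ (F : Finset ℕ) (N : Set (Fin n → ℝ)), IsOpen N ∧ x ∈ N ∧ N ⊆ V ∧
        (∀ l ∈ F, x ∈ C l ∧ N ⊆ W l) ∧ (∀ l ∉ F, ∀ y ∈ N, y ∉ C l) ∧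
        ∀ y ∈ N, ∑ l ∈ F, ψ l y = 1 := by
  let O : TopologicalSpace.Opens (Fin n → ℝ) := ⟨V, hV⟩
  have : LocallyCompactSpace O := hV.locallyCompactSpace
  have : SigmaCompactSpace O := sigmaCompactSpace_of_locallyCompact_secondCountable
  obtain ⟨ρ, hρ⟩ := SmoothPartitionOfUnity.exists_isSubordinate 𝓘(ℝ, Fin n → ℝ) (M := O)
    (s := Set.univ) isClosed_univ (fun l => Subtype.val ⁻¹' (W l))
    (fun l => (hW l).preimage continuous_subtype_val)
    (fun x _ => by simpa using hVW x.2)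
  have hC : ∀ l, ∃ C : Set (Fin n → ℝ), IsClosed C ∧ (Subtype.val : O → _) ⁻¹' C = tsupport (ρ l) :=
    fun l => isClosed_induced_iff.1 (isClosed_tsupport _)
  choose C hCc hCe using hC
  have hCm : ∀ l (x : O), (x : Fin n → ℝ) ∈ C l ↔ x ∈ tsupport (ρ l) := fun l x => by
    rw [← hCe l]; rfl
  let ψ : ℕ → (Fin n → ℝ) → ℝ := fun l => Function.extend (Subtype.val : O → _) (ρ l) 0
  have hψ : ∀ l (x : O), ψ l x = ρ l x := fun l x =>
    Subtype.val_injective.extend_apply (ρ l) 0 x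
  refine ⟨ψ, C, ?_, hCc, ?_, ?_, ?_⟩
  · intro l x hx
    have h1 : ContMDiffAt 𝓘(ℝ, Fin n → ℝ) 𝓘(ℝ) ∞ (fun y : O => ψ l y) ⟨x, hx⟩ := by
      have : (fun y : O => ψ l y) = ρ l := funext (hψ l)
      rw [this]
      exact (ρ l).contMDiff.contMDiffAt
    rw [contMDiffAt_subtype_iff] at h1
    exact h1.contDiffAt.contDiffWithinAt
  · rintro l x ⟨hx, hxV⟩
    exact hρ l ((hCm l ⟨x, hxV⟩).1 hx)
  · intro l x hx hxC
    rw [hψ l ⟨x, hx⟩]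
    exact image_eq_zero_of_notMem_tsupport (fun h => hxC ((hCm l ⟨x, hx⟩).2 h))
  · intro x hx
    let x' : O := ⟨x, hx⟩
    have e1 := ρ.eventually_fintsupport_subset x'
    have e2 : ∀ᶠ y : O in 𝓝 x', ∀ l ∈ ρ.fintsupport x', (y : Fin n → ℝ) ∈ W l := by
      rw [Filter.eventually_all_finset]
      intro l hl
      rw [ρ.mem_fintsupport_iff] at hl
      exact ((hW l).preimage continuous_subtype_val).mem_nhds (hρ l hl)
    obtain ⟨N, hN, hNo, hxN⟩ := mem_nhds_iff.1 (e1.and e2)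
    refine ⟨ρ.fintsupport x', Subtype.val '' N, hV.isOpenMap_subtype_val N hNo, ⟨x', hxN, rfl⟩,
      ?_, ?_, ?_, ?_⟩
    · rintro _ ⟨y, -, rfl⟩
      exact y.2
    · intro l hl
      refine ⟨(hCm l x').2 ((ρ.mem_fintsupport_iff _ _).1 hl), ?_⟩
      rintro _ ⟨y, hy, rfl⟩
      exact (hN hy).2 l hl
    · rintro l hl _ ⟨y, hy, rfl⟩ hyC
      exact hl ((hN hy).1 ((ρ.mem_fintsupport_iff _ _).2 ((hCm l y).1 hyC)))
    · rintro _ ⟨y, hy, rfl⟩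
      simp only [hψ]
      exact ρ.sum_finsupport' y (Set.mem_univ y)
        ((ρ.finsupport_subset_fintsupport y).trans (hN hy).1)

/-- gluing property of the presheaf of multi-foam algebras — families of
smooth functions on the members of an open cover of `V` that are pairwise compatible
modulo `J` glue, modulo `J`, to a family of smooth functions on `V`. -/
theorem stmt13 {n : ℕ} (hn : 0 < n) (X : Set (Fin n → ℝ)) (hXo : IsOpen X) (hXne : X.Nonempty)
    (Λ : Type*) [PartialOrder Λ] [Nonempty Λ] (hdir : RightDirected Λ)
    (S : Set (Set (Fin n → ℝ))) (hS : Admissible X S) (hlfa : LFA X S) (hcr : CRstable X S)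
    (V : Set (Fin n → ℝ)) (hVX : V ⊆ X) (hVo : IsOpen V) (hVne : V.Nonempty)
    {ι : Type*} (Vi : ι → Set (Fin n → ℝ)) (hVio : ∀ i, IsOpen (Vi i))
    (hVU : V = ⋃ i, Vi i)
    (t : ι → Λ → (Fin n → ℝ) → ℝ) (hts : ∀ i m, ContDiffOn ℝ (⊤ : ℕ∞) (t i m) (Vi i))
    (hcomp : ∀ i j : ι, (Vi i ∩ Vi j).Nonempty →
      ∃ Sg ∈ S, JvanP Λ (Vi i ∩ Vi j) (Sg ∩ (Vi i ∩ Vi j)) (fun m => t i m - t j m)) :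
    ∃ tt : Λ → (Fin n → ℝ) → ℝ,
      (∀ m, ContDiffOn ℝ (⊤ : ℕ∞) (tt m) V) ∧
      ∀ i : ι, ∃ Sg ∈ S, JvanP Λ (Vi i) (Sg ∩ Vi i) (fun m => tt m - t i m) := by
  classical
  obtain ⟨T, hTc, hTU⟩ := TopologicalSpace.isOpen_iUnion_countable Vi hVio
  have hTne : T.Nonempty := by
    obtain ⟨x, hx⟩ := hVne
    rw [hVU, ← hTU] at hx
    obtain ⟨i, hi, -⟩ := Set.mem_iUnion₂.1 hx
    exact ⟨i, hi⟩
  obtain ⟨e, he⟩ := hTc.exists_eq_range hTne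
  have hVW : V ⊆ ⋃ l : ℕ, Vi (e l) := by
    rw [hVU, ← hTU, he, Set.biUnion_range]
  have hiV : ∀ i, Vi i ⊆ V := fun i => by
    rw [hVU]
    exact Set.subset_iUnion Vi i
  obtain ⟨ψ, C, hψs, hCc, hCW, hψ0, hloc⟩ :=
    pou_exists hVo (fun l => Vi (e l)) (fun l => hVio _) hVW
  let tt : Λ → (Fin n → ℝ) → ℝ := fun m y => ∑ᶠ l, ψ l y * t (e l) m y
  have htt : ∀ (F : Finset ℕ) (N : Set (Fin n → ℝ)), N ⊆ V → (∀ l ∉ F, ∀ y ∈ N, y ∉ C l) →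
      ∀ m, ∀ y ∈ N, tt m y = ∑ l ∈ F, ψ l y * t (e l) m y := by
    intro F N hNV hF m y hy
    apply finsum_eq_sum_of_support_subset
    intro l hl
    by_contra hlF
    apply hl
    simp only [hψ0 l y (hNV hy) (hF l hlF y hy), zero_mul]
  refine ⟨tt, ?_, ?_⟩
  · intro m x hx
    obtain ⟨F, N, hNo, hxN, hNV, hF1, hF2, -⟩ := hloc x hx
    have h1 : ContDiffOn ℝ (⊤ : ℕ∞) (fun y => ∑ l ∈ F, ψ l y * t (e l) m y) N :=
      ContDiffOn.sum fun l hl =>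
        ((hψs l).mono hNV).mul ((hts (e l) m).mono (hF1 l hl).2)
    have h2 : ContDiffOn ℝ (⊤ : ℕ∞) (tt m) N := h1.congr (htt F N hNV hF2 m)
    exact (h2.contDiffAt (hNo.mem_nhds hxN)).contDiffWithinAt
  · intro i
    by_cases hne : (Vi i).Nonempty
    swap
    · obtain ⟨Sg, hSg⟩ := hS.1
      exact ⟨Sg, hSg, fun x hx => absurd ⟨x, hx.1⟩ hne⟩
    have hpair : ∀ l, ∃ Sg ∈ S, JvanP Λ (Vi (e l) ∩ Vi i) (Sg ∩ (Vi (e l) ∩ Vi i))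
        (fun m => t (e l) m - t i m) := by
      intro l
      by_cases h : (Vi (e l) ∩ Vi i).Nonempty
      · exact hcomp _ _ h
      · obtain ⟨Sg, hSg⟩ := hS.1
        exact ⟨Sg, hSg, fun x hx => absurd ⟨x, hx.1⟩ h⟩
    choose A hAS hA using hpair
    have hcr' : ∀ l, ∃ B ∈ S, B ∩ Vi i = A l ∩ (C l ∩ Vi i) := fun l =>
      hcr (A l) (hAS l) (Vi i) ((hiV i).trans hVX) (hVio i) hne (C l ∩ Vi i)
        Set.inter_subset_right ⟨C l, hCc l, rfl⟩
    choose B hBS hB using hcr'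
    obtain ⟨Sg, hSgS, hSg⟩ := hlfa B hBS (Vi i) ((hiV i).trans hVX) (hVio i) hne (by
      intro x hx
      obtain ⟨F, N, hNo, hxN, hNV, hF1, hF2, -⟩ := hloc x (hiV i hx)
      refine ⟨N ∩ Vi i, Set.inter_subset_right, Filter.inter_mem (hNo.mem_nhds hxN)
        ((hVio i).mem_nhds hx), F.finite_toSet.subset ?_⟩
      rintro l ⟨y, hyB, hyN, hyV⟩
      by_contra hl
      have : y ∈ A l ∩ (C l ∩ Vi i) := by
        rw [← hB l]
        exact ⟨hyB, hyV⟩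
      exact hF2 l hl y hyN this.2.1)
    refine ⟨Sg, hSgS, ?_⟩
    rintro x ⟨hx, hxS⟩
    rw [← hSg] at hxS
    obtain ⟨F, N, hNo, hxN, hNV, hF1, hF2, hF3⟩ := hloc x (hiV i hx)
    have hex : ∀ l ∈ F, ∃ a : Λ, ∀ m : Λ, a ≤ m → ∀ p : Fin n → ℕ,
        Dpartial p (t (e l) m - t i m) x = 0 := by
      intro l hl
      apply hA l x
      refine ⟨⟨(hF1 l hl).2 hxN, hx⟩, ?_⟩
      rintro ⟨hxA, -⟩
      apply hxS
      have : x ∈ B l ∩ Vi i := by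
        rw [hB l]
        exact ⟨hxA, (hF1 l hl).1, hx⟩
      exact ⟨Set.mem_iUnion.2 ⟨l, this.1⟩, hx⟩
    choose! a ha using hex
    have : IsDirectedOrder Λ := ⟨hdir⟩
    obtain ⟨b, hb⟩ := (F.image a).exists_le
    refine ⟨b, fun m hm => ?_⟩
    rw [flat_iff]
    have hWo : IsOpen (N ∩ Vi i) := hNo.inter (hVio i)
    have hxW : x ∈ N ∩ Vi i := ⟨hxN, hx⟩
    have hsm : ∀ l ∈ F, ContDiffOn ℝ (⊤ : ℕ∞) (t (e l) m - t i m) (N ∩ Vi i) := fun l hl =>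
      ((hts (e l) m).mono (Set.inter_subset_left.trans (hF1 l hl).2)).sub
        ((hts i m).mono Set.inter_subset_right)
    have hψm : ∀ l, ContDiffOn ℝ (⊤ : ℕ∞) (ψ l) (N ∩ Vi i) := fun l =>
      (hψs l).mono (Set.inter_subset_left.trans hNV)
    refine FlatL.congr hWo hxW _ ?_ (FlatL.sum hWo hxW _ F
      (fun l => ψ l * (t (e l) m - t i m)) (fun l hl => (hψm l).mul (hsm l hl))
      (fun l hl => FlatL.mul hWo hxW _ (hψm l) (hsm l hl) ((flat_iff _ _).1
        (ha l hl m ((hb _ (Finset.mem_image_of_mem a hl)).trans hm))))).2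
    rintro y ⟨hyN, -⟩
    simp only [Finset.sum_apply, Pi.mul_apply, Pi.sub_apply]
    rw [htt F N hNV hF2 m y hyN]
    simp only [mul_sub, Finset.sum_sub_distrib]
    rw [← Finset.sum_mul, hF3 y hyN, one_mul]
end

section
/- Let Λ be a right directed partially ordered set admitting an order embedding e : ℕ → Λ (e(l) ≤ e(k) if and only if l ≤ k) whose image is cofinal in Λ (for every λ ∈ Λ there is l ∈ ℕ with λ ≤ e(l)). Let V' ⊆ V be nonempty open subsets of X. Then for every t' ∈ (C^∞(V'))^Λ there exists t ∈ (C^∞(V))^Λ such that the family (t_λ|_{V'} − t'_λ)_{λ∈Λ} belongs to J_{Λ,∅}(V'), the asymptotically vanishing ideal on V' with empty singularity set. Consequently, for every admissible family S of subsets of X, the restriction homomorphism B_{Λ,S|_V}(V) → B_{Λ,S|_{V'}}(V') between multi-foam algebras is surjective (flabbiness of the multi-foam sheaf). -/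
open scoped Topology

set_option synthInstance.maxHeartbeats 1000000
set_option maxHeartbeats 1000000

theorem pderivI_iter_zero {n : ℕ} (i : Fin n) (k : ℕ) (f : (Fin n → ℝ) → ℝ) (x : Fin n → ℝ)
    (h : f =ᶠ[𝓝 x] (fun _ => 0)) : (pderivI i)^[k] f =ᶠ[𝓝 x] (fun _ => 0) := by
  induction k with
  | zero => exact h
  | succ k ih =>
    rw [Function.iterate_succ_apply']
    have := ih.fderiv (𝕜 := ℝ)
    filter_upwards [this] with y hy
    simp [pderivI, hy]

theorem Dpartial_zero_of_eventually {n : ℕ} (p : Fin n → ℕ) (f : (Fin n → ℝ) → ℝ)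
    (x : Fin n → ℝ) (h : f =ᶠ[𝓝 x] (fun _ => 0)) : Dpartial p f x = 0 := by
  have : Dpartial p f =ᶠ[𝓝 x] (fun _ => 0) := by
    unfold Dpartial
    induction (List.finRange n) with
    | nil => exact h
    | cons i l ih => exact pderivI_iter_zero i (p i) _ x ih
  exact this.eq_of_nhds

theorem exists_cutoffs {n : ℕ} (V : Set (Fin n → ℝ)) (hV : IsOpen V) :
    ∃ f : ℕ → (Fin n → ℝ) → ℝ, (∀ k, ContDiff ℝ (⊤ : ℕ∞) (f k)) ∧
      (∀ k, ∀ x ∉ V, f k =ᶠ[𝓝 x] (fun _ => 0)) ∧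
      (∀ x ∈ V, ∃ N, ∀ k ≥ N, f k =ᶠ[𝓝 x] (fun _ => 1)) := by
  have key : ∀ k : ℕ, ∃ f : (Fin n → ℝ) → ℝ, ContDiff ℝ (⊤ : ℕ∞) f ∧
      (∀ x ∉ V, f =ᶠ[𝓝 x] (fun _ => 0)) ∧
      (∀ x, (k : ENNReal)⁻¹ ≤ Metric.infEDist x Vᶜ → f =ᶠ[𝓝 x] (fun _ => 1)) := by
    intro k
    have hc : IsClosed {x : Fin n → ℝ | (k : ENNReal)⁻¹ ≤ Metric.infEDist x Vᶜ} :=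
      isClosed_le continuous_const Metric.continuous_infEDist
    have hd : Disjoint Vᶜ {x : Fin n → ℝ | (k : ENNReal)⁻¹ ≤ Metric.infEDist x Vᶜ} := by
      rw [Set.disjoint_left]
      intro x hx hx'
      have h0 : Metric.infEDist x Vᶜ = 0 := Metric.infEDist_zero_of_mem hx
      simp [h0] at hx'
    obtain ⟨f, h0, h1, -⟩ := exists_contMDiffMap_zero_one_nhds_of_isClosed
      (n := (⊤ : ℕ∞))
      (modelWithCornersSelf ℝ (Fin n → ℝ)) hV.isClosed_compl hc hd
    refine ⟨f, f.contMDiff.contDiff, fun x hx => ?_, fun x hx => ?_⟩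
    · exact h0.filter_mono (nhds_le_nhdsSet hx)
    · have hx' : x ∈ {x : Fin n → ℝ | (k : ENNReal)⁻¹ ≤ Metric.infEDist x Vᶜ} := hx
      exact h1.filter_mono (nhds_le_nhdsSet hx')
  choose f hf h0 h1 using key
  refine ⟨f, hf, h0, fun x hx => ?_⟩
  have hne : Metric.infEDist x Vᶜ ≠ 0 := by
    intro h
    exact (Metric.mem_iff_infEDist_zero_of_closed hV.isClosed_compl).2 h hx
  obtain ⟨N, hN⟩ := ENNReal.exists_inv_nat_lt hne
  refine ⟨N, fun k hk => h1 k x (le_trans ?_ hN.le)⟩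
  exact ENNReal.inv_le_inv.2 (by exact_mod_cast hk)

theorem extend_aux {n : ℕ} (Λ : Type*) [PartialOrder Λ]
    (e : ℕ → Λ) (he : ∀ k l : ℕ, e k ≤ e l ↔ k ≤ l) (hecof : ∀ a : Λ, ∃ l : ℕ, a ≤ e l)
    (V' V : Set (Fin n → ℝ)) (hV'o : IsOpen V')
    (t' : Λ → (Fin n → ℝ) → ℝ) (ht' : ∀ m, ContDiffOn ℝ (⊤ : ℕ∞) (t' m) V') :
    ∃ t : Λ → (Fin n → ℝ) → ℝ, (∀ m, ContDiffOn ℝ (⊤ : ℕ∞) (t m) V) ∧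
        JvanP Λ V' (∅ : Set (Fin n → ℝ)) (fun m => t m - t' m) := by
  obtain ⟨f, hf, h0, h1⟩ := exists_cutoffs V' hV'o
  have hbdd : ∀ m : Λ, BddAbove {k : ℕ | e k ≤ m} := by
    intro m
    obtain ⟨l, hl⟩ := hecof m
    exact ⟨l, fun k hk => (he k l).1 (le_trans hk hl)⟩
  refine ⟨fun m => f (sSup {k : ℕ | e k ≤ m}) * t' m, fun m => ?_, ?_⟩
  · refine ContDiff.contDiffOn ?_
    rw [contDiff_iff_contDiffAt]
    intro x
    by_cases hx : x ∈ V'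
    · exact (hf _).contDiffAt.mul ((ht' m).contDiffAt (hV'o.mem_nhds hx))
    · refine (contDiffAt_const (c := (0 : ℝ))).congr_of_eventuallyEq ?_
      filter_upwards [h0 (sSup {k : ℕ | e k ≤ m}) x hx] with y hy
      simp [hy]
  · rintro x ⟨hx, -⟩
    obtain ⟨N, hN⟩ := h1 x hx
    refine ⟨e N, fun m hm p => Dpartial_zero_of_eventually p _ x ?_⟩
    filter_upwards [hN _ (le_csSup (hbdd m) hm)] with y hy
    simp [hy]

/-- Termwise restriction of families. -/
def restrFam {n : ℕ} (Λ : Type*) {V' V : Set (Fin n → ℝ)} (hsub : V' ⊆ V) :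
    (Λ → SmoothA n V) →ₐ[ℝ] (Λ → SmoothA n V') where
  toFun w := fun m => ⟨(w m : (Fin n → ℝ) → ℝ), (w m).2.mono hsub⟩
  map_one' := rfl
  map_mul' _ _ := rfl
  map_zero' := rfl
  map_add' _ _ := rfl
  commutes' _ := rfl

/-- flabbiness of the multi-foam sheaf — every family of smooth functions on
`V'` extends, modulo the ideal `J_{Λ,∅}(V')`, to a family of smooth functions on `V`;
consequently every restriction homomorphism `B_{Λ,S|_V}(V) → B_{Λ,S|_{V'}}(V')` is
surjective. -/
theorem stmt14 {n : ℕ} (hn : 0 < n) (X : Set (Fin n → ℝ)) (hXo : IsOpen X) (hXne : X.Nonempty)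
    (Λ : Type*) [PartialOrder Λ] (hdir : RightDirected Λ)
    (e : ℕ → Λ) (he : ∀ k l : ℕ, e k ≤ e l ↔ k ≤ l) (hecof : ∀ a : Λ, ∃ l : ℕ, a ≤ e l)
    (V' V : Set (Fin n → ℝ)) (hsub : V' ⊆ V) (hVX : V ⊆ X)
    (hV'o : IsOpen V') (hV'ne : V'.Nonempty) (hVo : IsOpen V) (hVne : V.Nonempty) :
    (∀ t' : Λ → (Fin n → ℝ) → ℝ, (∀ m, ContDiffOn ℝ (⊤ : ℕ∞) (t' m) V') →
      ∃ t : Λ → (Fin n → ℝ) → ℝ, (∀ m, ContDiffOn ℝ (⊤ : ℕ∞) (t m) V) ∧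
        JvanP Λ V' (∅ : Set (Fin n → ℝ)) (fun m => t m - t' m)) ∧
    (∀ S : Set (Set (Fin n → ℝ)), Admissible X S →
      ∃ F : ((Λ → SmoothA n V) ⧸ Ideal.span (JsetFamU Λ V S)) →ₐ[ℝ]
            ((Λ → SmoothA n V') ⧸ Ideal.span (JsetFamU Λ V' S)),
        (∀ w : Λ → SmoothA n V,
          F (Ideal.Quotient.mk (Ideal.span (JsetFamU Λ V S)) w)
            = Ideal.Quotient.mk (Ideal.span (JsetFamU Λ V' S))
                (fun m => (⟨(w m : (Fin n → ℝ) → ℝ), (w m).2.mono hsub⟩ : SmoothA n V'))) ∧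
        Function.Surjective F) := by
  refine ⟨fun t' ht' => extend_aux Λ e he hecof V' V hV'o t' ht', fun S hS => ?_⟩
  have hle : Ideal.span (JsetFamU Λ V S) ≤
      (Ideal.span (JsetFamU Λ V' S)).comap (restrFam Λ hsub) := by
    rw [Ideal.span_le]
    rintro w ⟨Sg, hSg, hw⟩
    refine Ideal.subset_span ⟨Sg, hSg, ?_⟩
    rintro x ⟨hx, hxS⟩
    exact hw x ⟨hsub hx, fun h => hxS ⟨h.1, hx⟩⟩
  refine ⟨Ideal.quotientMapₐ _ (restrFam Λ hsub) hle, fun w => rfl, fun y => ?_⟩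
  obtain ⟨t', rfl⟩ := Ideal.Quotient.mk_surjective y
  obtain ⟨t, ht, hJ⟩ := extend_aux Λ e he hecof V' V hV'o
    (fun m => (t' m : (Fin n → ℝ) → ℝ)) (fun m => (t' m).2)
  refine ⟨Ideal.Quotient.mk _ (fun m => (⟨t m, ht m⟩ : SmoothA n V)), ?_⟩
  refine (Ideal.Quotient.eq (x := restrFam Λ hsub (fun m => (⟨t m, ht m⟩ : SmoothA n V)))).2 ?_
  obtain ⟨Sg, hSg⟩ := hS.1
  refine Ideal.subset_span ⟨Sg, hSg, ?_⟩
  rintro x ⟨hx, -⟩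
  exact hJ x ⟨hx, fun h => h⟩
end
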